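/- Let f : [0,1] → ℝ be Riemann integrable. Then for every k ∈ ℕ, the set { x ∈ [0,1] : osc_f(x) ≥ 2^{−k} } has Lebesgue measure zero. -/

import Mathlib

open Filter Set MeasureTheory

/-- Riemann sum of `f` for the tagged partition given by points `x 0, …, x m` and tags `t`. -/
noncomputable def riemannSum (f : ℝ → ℝ) (m : ℕ) (x t : ℕ → ℝ) : ℝ :=
  ∑ i ∈ Finset.range m, f (t i) * (x (i + 1) - x i)

/-- `f` is Riemann integrable on `[0,1]` with integral `I`. -/
def RiemannIntegrableTo (f : ℝ → ℝ) (I : ℝ) : Prop :=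
  ∀ ε > (0:ℝ), ∃ δ > (0:ℝ), ∀ (m : ℕ) (x t : ℕ → ℝ),
    x 0 = 0 → x m = 1 →
    (∀ i < m, x i ≤ t i ∧ t i ≤ x (i + 1)) →
    (∀ i < m, x (i + 1) - x i < δ) →
    |riemannSum f m x t - I| < ε

/-- `f` is Riemann integrable on `[0,1]`. -/
def RiemannIntegrable (f : ℝ → ℝ) : Prop :=
  ∃ I : ℝ, RiemannIntegrableTo f I

/-- The oscillation of `f : [0,1] → ℝ` at `x`, i.e. the limit as `δ → 0⁺` (equivalently, the
infimum over `δ > 0`) of `sup f - inf f` over `{y ∈ [0,1] : |y - x| < δ}`. -/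
noncomputable def osc (f : ℝ → ℝ) (x : ℝ) : ℝ :=
  ⨅ δ : {d : ℝ // 0 < d},
    (sSup (f '' {y | y ∈ Set.Icc (0:ℝ) 1 ∧ |y - x| < (δ : ℝ)}) -
      sInf (f '' {y | y ∈ Set.Icc (0:ℝ) 1 ∧ |y - x| < (δ : ℝ)}))

/-- If the oscillation of `f` at `x` is at least `c > 0`, then `f` takes values differing by more
than `c / 2` arbitrarily close to `x`. -/
theorem exists_half_lt_sub_of_le_osc {f : ℝ → ℝ} {x c : ℝ} (hx : x ∈ Icc (0:ℝ) 1) (hc : 0 < c)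
    (hosc : c ≤ osc f x) {δ : ℝ} (hδ : 0 < δ) :
    ∃ y z, |y - x| < δ ∧ |z - x| < δ ∧ c / 2 < f y - f z := by
  by_contra! hcon
  set S := f '' {y | y ∈ Icc (0:ℝ) 1 ∧ |y - x| < δ}
  have hne : S.Nonempty := ⟨f x, x, ⟨hx, by simpa using hδ⟩, rfl⟩
  have hle : osc f x ≤ sSup S - sInf S := by
    refine ciInf_le ?_ (⟨δ, hδ⟩ : {d : ℝ // 0 < d})
    by_contra hb
    have h0 : osc f x = 0 := Real.sInf_of_not_bddBelow hb
    linarith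
  have hdiff : ∀ a ∈ S, ∀ b ∈ S, a - c / 2 ≤ b := by
    rintro _ ⟨y, hy, rfl⟩ _ ⟨z, hz, rfl⟩
    linarith [hcon y z hy.2 hz.2]
  have hsup : sSup S ≤ sInf S + c / 2 := by
    refine csSup_le hne fun a ha => ?_
    linarith [le_csInf hne (hdiff a ha)]
  linarith

/-- If `f` is Riemann integrable and varies by more than `c` on every neighbourhood of every point
of `E ⊆ [0,1]`, where `c > 0`, then `E` is a null set. -/
theorem RiemannIntegrable.volume_eq_zero {f : ℝ → ℝ} (hf : RiemannIntegrable f) {E : Set ℝ} {c : ℝ}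
    (hc : 0 < c) (hE : E ⊆ Icc 0 1)
    (hvar : ∀ x ∈ E, ∀ δ > 0, ∃ y z, |y - x| < δ ∧ |z - x| < δ ∧ c < f y - f z) :
    volume E = 0 := by
  classical
  obtain ⟨I, hI⟩ := hf
  suffices hsmall : ∀ ε : ℝ, 0 < ε → volume E ≤ ENNReal.ofReal ε by
    refine le_antisymm (ENNReal.le_of_forall_pos_le_add fun ε hε _ => ?_) zero_le
    simpa using hsmall ε hε
  intro ε hε
  obtain ⟨δ, hδ, hsum⟩ := hI (ε * c / 2) (by positivity)
  obtain ⟨N, hN⟩ := exists_nat_one_div_lt hδ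
  set h : ℝ := 1 / ((N : ℝ) + 1) with hh
  have hpos : 0 < h := by positivity
  have hNh : ((N + 1 : ℕ) : ℝ) * h = 1 := by rw [hh]; push_cast; field_simp
  let J : ℕ → Set ℝ := fun i => Ioo (i * h) ((i + 1 : ℕ) * h)
  have hJ : ∀ i, volume (J i) = ENNReal.ofReal h := fun i => by
    simp only [J, Real.volume_Ioo]; congr 1; push_cast; ring
  have hpick : ∀ i : ℕ, ∃ u v, (i * h ≤ u ∧ u ≤ (i + 1 : ℕ) * h) ∧
      (i * h ≤ v ∧ v ≤ (i + 1 : ℕ) * h) ∧ 0 ≤ f u - f v ∧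
      ((E ∩ J i).Nonempty → c < f u - f v) := by
    intro i
    by_cases hi : (E ∩ J i).Nonempty
    · obtain ⟨x, hxE, hx1, hx2⟩ := hi
      obtain ⟨y, z, hy, hz, hyz⟩ := hvar x hxE (min (x - i * h) ((i + 1 : ℕ) * h - x))
        (lt_min (by linarith) (by linarith))
      rw [lt_min_iff, abs_lt, abs_lt] at hy hz
      exact ⟨y, z, ⟨by linarith [hy.1.1], by linarith [hy.2.2]⟩,
        ⟨by linarith [hz.1.1], by linarith [hz.2.2]⟩, by linarith, fun _ => hyz⟩
    · have : (i : ℝ) * h ≤ (i + 1 : ℕ) * h := by push_cast; linarith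
      exact ⟨i * h, i * h, ⟨le_rfl, this⟩, ⟨le_rfl, this⟩, by simp, fun hne => absurd hne hi⟩
  choose u v hu hv huv0 huv using hpick
  have hmesh : ∀ i < N + 1, ((i + 1 : ℕ) : ℝ) * h - i * h < δ := by
    intro i _
    have : ((i + 1 : ℕ) : ℝ) * h - i * h = h := by push_cast; ring
    linarith
  have hsu := hsum (N + 1) (fun i => i * h) u (by simp) hNh (fun i _ => hu i) hmesh
  have hsv := hsum (N + 1) (fun i => i * h) v (by simp) hNh (fun i _ => hv i) hmesh
  set B := {i ∈ Finset.range (N + 1) | (E ∩ J i).Nonempty}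
  have hdiff : riemannSum f (N + 1) (fun i => i * h) u - riemannSum f (N + 1) (fun i => i * h) v
      = ∑ i ∈ Finset.range (N + 1), (f (u i) - f (v i)) * h := by
    simp only [riemannSum, ← Finset.sum_sub_distrib]
    refine Finset.sum_congr rfl fun i _ => ?_
    push_cast; ring
  have hcard : (B.card : ℝ) * h ≤ ε := by
    have hlow : (B.card : ℝ) * (c * h) ≤
        ∑ i ∈ Finset.range (N + 1), (f (u i) - f (v i)) * h := by
      rw [← nsmul_eq_mul, ← Finset.sum_const]
      refine (Finset.sum_le_sum fun i hi => ?_).trans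
        (Finset.sum_le_sum_of_subset_of_nonneg (Finset.filter_subset _ _)
          fun i _ _ => mul_nonneg (huv0 i) hpos.le)
      exact mul_le_mul_of_nonneg_right (huv i (Finset.mem_filter.mp hi).2).le hpos.le
    rw [abs_lt] at hsu hsv
    refine le_of_mul_le_mul_right ?_ hc
    linarith
  have hcover : E ⊆ (⋃ i ∈ B, J i) ∪ range fun i : ℕ => (i : ℝ) * h := by
    intro x hx
    obtain ⟨hx0, hx1⟩ := hE hx
    have h1 : (⌊x / h⌋₊ : ℝ) * h ≤ x := (le_div_iff₀ hpos).mp (Nat.floor_le (by positivity))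
    have h2 : x < (⌊x / h⌋₊ + 1 : ℕ) * h := by
      have := (div_lt_iff₀ hpos).mp (Nat.lt_floor_add_one (x / h))
      exact_mod_cast this
    rcases h1.eq_or_lt with h1 | h1
    · exact Or.inr ⟨_, h1⟩
    · refine Or.inl (mem_biUnion (Finset.mem_filter.mpr ⟨Finset.mem_range.mpr ?_, x, hx, h1, h2⟩)
        ⟨h1, h2⟩)
      exact_mod_cast lt_of_mul_lt_mul_right ((h1.trans_le hx1).trans_eq hNh.symm) hpos.le
  calc volume E ≤ volume (⋃ i ∈ B, J i) + volume (range fun i : ℕ => (i : ℝ) * h) :=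
        (measure_mono hcover).trans (measure_union_le _ _)
    _ = volume (⋃ i ∈ B, J i) := by rw [(countable_range _).measure_zero, add_zero]
    _ ≤ ∑ i ∈ B, volume (J i) := measure_biUnion_finset_le _ _
    _ = ENNReal.ofReal (B.card * h) := by
        simp only [hJ, Finset.sum_const, nsmul_eq_mul]
        rw [ENNReal.ofReal_mul (Nat.cast_nonneg _), ENNReal.ofReal_natCast]
    _ ≤ ENNReal.ofReal ε := ENNReal.ofReal_le_ofReal hcard

theorem stmt15 (f : ℝ → ℝ) (hf : RiemannIntegrable f) (k : ℕ) :
    volume {x ∈ Set.Icc (0:ℝ) 1 | 1 / 2 ^ k ≤ osc f x} = 0 := by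
  have hc : (0:ℝ) < 1 / 2 ^ k := by positivity
  exact hf.volume_eq_zero (half_pos hc) (fun x hx => hx.1)
    fun x hx δ hδ => exists_half_lt_sub_of_le_osc hx.1 hc hx.2 hδ
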